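/- arXiv:2501.03697 — 6 statements merged into one kernel-verified Lean document; each statement's English description precedes it below -/
import Mathlib

section
/- Let X and Ω be sets and let K : X × Ω → ℝ be independently bounded. Then there exists an RKBS pair (B, B⋄) with B an RKBS on X and B⋄ an RKBS on Ω whose reproducing kernel is K. -/
/-!
STATEMENT 1: Let X and Ω be sets and let K : X × Ω → ℝ be independently bounded.
Then there exists an RKBS pair (B, B⋄) with B an RKBS on X and B⋄ an RKBS on Ω whose
reproducing kernel is K.
-/

noncomputable section

universe u v

/-- A pair of Banach spaces of functions on `X` and `Ω` respectively, together with a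
bilinear pairing between them. -/
structure RKBSPair (X : Type u) (Ω : Type v) where
  B : Type (max u v)
  Bd : Type (max u v)
  [nB : NormedAddCommGroup B]
  [sB : NormedSpace ℝ B]
  [cB : CompleteSpace B]
  [nBd : NormedAddCommGroup Bd]
  [sBd : NormedSpace ℝ Bd]
  [cBd : CompleteSpace Bd]
  evB : B →ₗ[ℝ] (X → ℝ)
  evBd : Bd →ₗ[ℝ] (Ω → ℝ)
  dpair : Bd →ₗ[ℝ] B →ₗ[ℝ] ℝ

attribute [instance] RKBSPair.nB RKBSPair.sB RKBSPair.cB RKBSPair.nBd RKBSPair.sBd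
  RKBSPair.cBd

/-- `P` is an RKBS pair: both sides are Banach spaces of functions (the evaluation maps
are injective) with bounded point evaluations, and the pairing is bounded and
non-degenerate. -/
def RKBSPair.IsRKBS {X : Type u} {Ω : Type v} (P : RKBSPair X Ω) : Prop :=
  Function.Injective P.evB ∧ Function.Injective P.evBd ∧
  (∀ x : X, ∃ C : ℝ, 0 < C ∧ ∀ f : P.B, |P.evB f x| ≤ C * ‖f‖) ∧
  (∀ w : Ω, ∃ C : ℝ, 0 < C ∧ ∀ g : P.Bd, |P.evBd g w| ≤ C * ‖g‖) ∧
  (∀ (g : P.Bd) (f : P.B), |P.dpair g f| ≤ ‖f‖ * ‖g‖) ∧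
  (∀ g : P.Bd, (∀ f : P.B, P.dpair g f = 0) → g = 0) ∧
  (∀ f : P.B, (∀ g : P.Bd, P.dpair g f = 0) → f = 0)

/-- `K` is a reproducing kernel of the pair `P`. -/
structure RKBSPair.IsKernelWith {X : Type u} {Ω : Type v} (P : RKBSPair X Ω)
    (K : X → Ω → ℝ) (Kx : X → P.Bd) (Kw : Ω → P.B) : Prop where
  evKx : ∀ x, P.evBd (Kx x) = K x
  evKw : ∀ w, P.evB (Kw w) = fun x => K x w
  reproB : ∀ (f : P.B) (x : X), P.dpair (Kx x) f = P.evB f x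
  reproBd : ∀ (g : P.Bd) (w : Ω), P.dpair g (Kw w) = P.evBd g w

/-- `P` has reproducing kernel `K`. -/
def RKBSPair.HasKernel {X : Type u} {Ω : Type v} (P : RKBSPair X Ω)
    (K : X → Ω → ℝ) : Prop :=
  ∃ (Kx : X → P.Bd) (Kw : Ω → P.B), P.IsKernelWith K Kx Kw

/-- Every independently bounded kernel `K : X × Ω → ℝ` is the
reproducing kernel of some RKBS pair on `(X, Ω)`. -/
theorem statement1 {X : Type u} {Ω : Type v} (K : X → Ω → ℝ)
    (CX : X → ℝ) (CΩ : Ω → ℝ) (hbdd : ∀ (x : X) (w : Ω), |K x w| ≤ CX x * CΩ w) :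
    ∃ P : RKBSPair X Ω, P.IsRKBS ∧ P.HasKernel K := by
  classical
  let c : X → ℝ := fun x => |CX x| + 1
  have hc : ∀ x, 0 < c x := fun x => by positivity
  let E := lp (fun _ : ULift.{v} X => ℝ) ⊤
  have hk : ∀ (w : Ω) (x : X), |K x w / c x| ≤ |CΩ w| := fun w x => by
    rw [abs_div, abs_of_pos (hc x), div_le_iff₀ (hc x)]
    calc |K x w| ≤ CX x * CΩ w := hbdd x w
      _ ≤ |CX x * CΩ w| := le_abs_self _
      _ = |CΩ w| * |CX x| := by rw [abs_mul, mul_comm]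
      _ ≤ |CΩ w| * c x := by
        apply mul_le_mul_of_nonneg_left _ (abs_nonneg _)
        simp [c]
  let k : Ω → E := fun w => ⟨fun x => K x.down w / c x.down, by
    apply memℓp_infty
    refine ⟨|CΩ w|, ?_⟩
    rintro _ ⟨x, rfl⟩
    exact hk w x.down⟩
  have hkapp : ∀ w x, (k w : ULift.{v} X → ℝ) x = K x.down w / c x.down := fun _ _ => rfl
  let S : Submodule ℝ E := (Submodule.span ℝ (Set.range k)).topologicalClosure
  have hkS : ∀ w, k w ∈ S := fun w =>
    Submodule.le_topologicalClosure _ (Submodule.subset_span ⟨w, rfl⟩)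
  have hScl : IsClosed (S : Set E) := Submodule.isClosed_topologicalClosure _
  have : CompleteSpace S := hScl.completeSpace_coe
  let kS : Ω → S := fun w => ⟨k w, hkS w⟩
  let ev : S →ₗ[ℝ] (X → ℝ) :=
    { toFun := fun f x => c x * ((f : E) : ULift.{v} X → ℝ) ⟨x⟩
      map_add' := fun f g => by
        funext x
        simp [mul_add]
      map_smul' := fun r f => by
        funext x
        exact mul_left_comm (c x) r (((f : E) : ULift.{v} X → ℝ) ⟨x⟩) }
  have hev : ∀ f x, ev f x = c x * ((f : E) : ULift.{v} X → ℝ) ⟨x⟩ := fun _ _ => rfl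
  have hevb : ∀ x f, |ev f x| ≤ c x * ‖f‖ := fun x f => by
    rw [hev, abs_mul, abs_of_pos (hc x)]
    exact mul_le_mul_of_nonneg_left
      (lp.norm_apply_le_norm (by simp) (f : E) (⟨x⟩ : ULift.{v} X)) (hc x).le
  let φ : X → StrongDual ℝ S := fun x =>
    LinearMap.mkContinuous ((LinearMap.proj x).comp ev) (c x) (fun f => hevb x f)
  have hφ : ∀ x f, φ x f = ev f x := fun _ _ => rfl
  have hevk : ∀ w x, ev (kS w) x = K x w := fun w x => by
    rw [hev]
    change c x * (K x w / c x) = _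
    exact mul_div_cancel₀ _ (hc x).ne'
  let evd : StrongDual ℝ S →ₗ[ℝ] (Ω → ℝ) :=
    { toFun := fun g w => g (kS w)
      map_add' := fun f g => rfl
      map_smul' := fun r f => rfl }
  have hevinj : Function.Injective ev := by
    intro f g h
    apply Subtype.ext
    apply lp.ext
    funext x
    have := congrFun h x.down
    rw [hev, hev] at this
    exact mul_left_cancel₀ (hc x.down).ne' this
  have hevdinj : Function.Injective evd := by
    rw [injective_iff_map_eq_zero]
    intro g hg
    have h0 : ∀ w, g (kS w) = 0 := fun w => congrFun hg w
    have key : ∀ (y : E) (hy : y ∈ Submodule.span ℝ (Set.range k)),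
        g ⟨y, Submodule.le_topologicalClosure _ hy⟩ = 0 := by
      intro y hy
      induction hy using Submodule.span_induction with
      | mem y h =>
        obtain ⟨w, rfl⟩ := h
        exact h0 w
      | zero => exact map_zero g
      | add a b ha hb iha ihb =>
        have := map_add g ⟨a, Submodule.le_topologicalClosure _ ha⟩
          ⟨b, Submodule.le_topologicalClosure _ hb⟩
        rw [iha, ihb, add_zero] at this
        exact this
      | smul r a ha iha =>
        have := map_smul g r ⟨a, Submodule.le_topologicalClosure _ ha⟩
        rw [iha, smul_zero] at this
        exact this
    ext ⟨y, hy⟩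
    have hy' : y ∈ closure (Submodule.span ℝ (Set.range k) : Set E) := hy
    obtain ⟨u, hu, hlim⟩ := mem_closure_iff_seq_limit.1 hy'
    have hl : Filter.Tendsto
        (fun n => (⟨u n, Submodule.le_topologicalClosure _ (hu n)⟩ : S)) Filter.atTop
        (nhds ⟨y, hy⟩) := tendsto_subtype_rng.2 hlim
    have h1 := (g.continuous.tendsto _).comp hl
    have h2 : (g ∘ fun n => (⟨u n, Submodule.le_topologicalClosure _ (hu n)⟩ : S))
        = fun _ => 0 := by
      funext n
      exact key _ (hu n)
    rw [h2] at h1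
    exact tendsto_nhds_unique h1 tendsto_const_nhds
  have hevdb : ∀ w : Ω, ∃ C : ℝ, 0 < C ∧ ∀ g : StrongDual ℝ S, |evd g w| ≤ C * ‖g‖ := by
    intro w
    refine ⟨‖kS w‖ + 1, by positivity, fun g => ?_⟩
    have h1 : |evd g w| ≤ ‖g‖ * ‖kS w‖ := g.le_opNorm (kS w)
    nlinarith [norm_nonneg g]
  let P : RKBSPair X Ω :=
    { B := S
      Bd := StrongDual ℝ S
      evB := ev
      evBd := evd
      dpair := ContinuousLinearMap.coeLM ℝ }
  refine ⟨P, ⟨hevinj, hevdinj, fun x => ⟨c x, hc x, hevb x⟩, ?_, ?_, ?_, ?_⟩, φ, kS, ?_, ?_, ?_, ?_⟩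
  · exact hevdb
  · intro g f
    rw [mul_comm]
    exact ContinuousLinearMap.le_opNorm (show StrongDual ℝ S from g) f
  · intro g h
    exact ContinuousLinearMap.ext h
  · intro f h
    apply hevinj
    rw [map_zero]
    funext x
    exact h (φ x)
  · intro x
    funext w
    exact hevk w x
  · intro w
    funext x
    exact hevk w x
  · intro f x
    rfl
  · intro g w
    rfl

end
end

section
/- Let (B¹, B¹⋄) be an RKBS pair on (X, Ω¹) with reproducing kernel K¹ and let (B̃², B̃²⋄) be an RKBS pair on (B¹⋄, Ω²) with reproducing kernel K̃². Then the chain spaces B² and B²⋄ form an RKBS pair on (X, Ω²) (i.e., B² is an RKBS on X, B²⋄ is an RKBS on Ω², and the inherited pairing is bounded and non-degenerate), and its reproducing kernel is K²(x,w) = K̃²(K¹_x, w) for all x ∈ X and w ∈ Ω². -/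
/-!
STATEMENT 2: Let (B¹, B¹⋄) be an RKBS pair on (X, Ω¹) with reproducing kernel K¹ and
let (B̃², B̃²⋄) be an RKBS pair on (B¹⋄, Ω²) with reproducing kernel K̃².  Then the chain
spaces B² and B²⋄ form an RKBS pair on (X, Ω²), and its reproducing kernel is
K²(x,w) = K̃²(K¹ₓ, w).
-/

noncomputable section

universe u v w

/-- `P2` is the chain of the initial pair `P1` (with evaluation functionals `Kx1`) and
the link pair `Pt` on `(B¹⋄, Ω²)`:
* the functions of `B²` are exactly the functions `A h : x ↦ h(K¹ₓ)` for `h ∈ B̃²`,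
  with the quotient norm `‖f‖ = inf {‖h‖ : A h = f}`;
* `B²⋄` is (isometrically) the subspace of `B̃²⋄` annihilating the null space of `A`,
  with inherited evaluations, norm and pairing. -/
def IsChainOf {X : Type u} {Ω1 : Type v} {Ω2 : Type w}
    (P1 : RKBSPair X Ω1) (Kx1 : X → P1.Bd)
    (Pt : RKBSPair P1.Bd Ω2) (P2 : RKBSPair X Ω2) : Prop :=
  (Set.range P2.evB = {f : X → ℝ | ∃ h : Pt.B, f = fun x => Pt.evB h (Kx1 x)}) ∧
  (∀ f : P2.B, ‖f‖ =
    sInf {r : ℝ | ∃ h : Pt.B, (P2.evB f = fun x => Pt.evB h (Kx1 x)) ∧ r = ‖h‖}) ∧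
  (Set.range P2.evBd = {g : Ω2 → ℝ | ∃ q : Pt.Bd,
      (∀ h : Pt.B, (∀ x, Pt.evB h (Kx1 x) = 0) → Pt.dpair q h = 0) ∧ g = Pt.evBd q}) ∧
  (∀ (g : P2.Bd) (q : Pt.Bd), Pt.evBd q = P2.evBd g → ‖g‖ = ‖q‖) ∧
  (∀ (g : P2.Bd) (q : Pt.Bd) (f : P2.B) (h : Pt.B),
      Pt.evBd q = P2.evBd g → (P2.evB f = fun x => Pt.evB h (Kx1 x)) →
      P2.dpair g f = Pt.dpair q h)

theorem exists_shrink_aux.{a, b} {V : Type a} [NormedAddCommGroup V] [NormedSpace ℝ V]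
    [CompleteSpace V] (hs : Small.{b} V) :
    ∃ (W : Type b) (_ : NormedAddCommGroup W) (_ : NormedSpace ℝ W) (_ : CompleteSpace W),
      Nonempty (W ≃ₗᵢ[ℝ] V) := by
  let e : Shrink.{b} V ≃ₗ[ℝ] V := Shrink.linearEquiv.{b} ℝ V
  letI i1 : NormedAddCommGroup (Shrink.{b} V) :=
    NormedAddCommGroup.induced (Shrink.{b} V) V e e.injective
  letI i2 : NormedSpace ℝ (Shrink.{b} V) := NormedSpace.induced ℝ (Shrink.{b} V) V e
  let E : Shrink.{b} V ≃ₗᵢ[ℝ] V := ⟨e, fun _ => rfl⟩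
  have i3 : CompleteSpace (Shrink.{b} V) :=
    (completeSpace_congr (e := E.toEquiv) E.isometry.isUniformEmbedding).2 inferInstance
  exact ⟨Shrink.{b} V, i1, i2, i3, ⟨E⟩⟩

theorem isClosed_ker_aux {V : Type*} [NormedAddCommGroup V] [NormedSpace ℝ V]
    (φ : V →ₗ[ℝ] ℝ) (C : ℝ) (h : ∀ v, |φ v| ≤ C * ‖v‖) : IsClosed {v | φ v = 0} :=
  isClosed_eq (φ.mkContinuous C h).continuous continuous_const

/-- **RKBS consistency.** The chain of an RKBS pair on `(X, Ω¹)` with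
kernel `K¹` and a link RKBS pair on `(B¹⋄, Ω²)` with kernel `K̃²` is again an RKBS pair
on `(X, Ω²)`, with reproducing kernel `K²(x, w) = K̃²(K¹ₓ, w)`. -/
theorem statement2 {X : Type u} {Ω1 : Type v} {Ω2 : Type w}
    (P1 : RKBSPair X Ω1) (hP1 : P1.IsRKBS)
    (K1 : X → Ω1 → ℝ) (Kx1 : X → P1.Bd) (Kw1 : Ω1 → P1.B)
    (hK1 : P1.IsKernelWith K1 Kx1 Kw1)
    (Pt : RKBSPair P1.Bd Ω2) (hPt : Pt.IsRKBS)
    (Kt : P1.Bd → Ω2 → ℝ) (Ktx : P1.Bd → Pt.Bd) (Ktw : Ω2 → Pt.B)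
    (hKt : Pt.IsKernelWith Kt Ktx Ktw) :
    ∃ P2 : RKBSPair X Ω2, IsChainOf P1 Kx1 Pt P2 ∧ P2.IsRKBS ∧
      P2.HasKernel (fun x w => Kt (Kx1 x) w) := by
  obtain ⟨ti, tdi, tb, tdb, tp, tn1, tn2⟩ := hPt
  -- the map A
  let A : Pt.B →ₗ[ℝ] (X → ℝ) := (LinearMap.funLeft ℝ ℝ Kx1).comp Pt.evB
  have hA : ∀ h, A h = fun x => Pt.evB h (Kx1 x) := fun h => rfl
  let N : Submodule ℝ Pt.B := LinearMap.ker A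
  have hNc : IsClosed (N : Set Pt.B) := by
    have : (N : Set Pt.B) = ⋂ x, {h | ((LinearMap.proj x).comp A) h = 0} := by
      ext h
      simp [N, funext_iff]
    rw [this]
    refine isClosed_iInter fun x => ?_
    obtain ⟨C, -, hC⟩ := tb (Kx1 x)
    exact isClosed_ker_aux _ C hC
  let D : Submodule ℝ Pt.Bd :=
    { carrier := {q | ∀ h ∈ N, Pt.dpair q h = 0}
      add_mem' := fun {a b} ha hb h hh => by simp [ha h hh, hb h hh]
      zero_mem' := fun h _ => by simp
      smul_mem' := fun c a ha h hh => by simp [ha h hh] }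
  have hDm : ∀ q, q ∈ D ↔ ∀ h ∈ N, Pt.dpair q h = 0 := fun q => Iff.rfl
  have hDc : IsClosed (D : Set Pt.Bd) := by
    have : (D : Set Pt.Bd) = ⋂ h ∈ N, {q | Pt.dpair.flip h q = 0} := by
      ext q
      simp [hDm]
    rw [this]
    exact isClosed_biInter fun h _ => isClosed_ker_aux _ ‖h‖ fun q => tp q h
  have hDcomp : CompleteSpace D := hDc.completeSpace_coe
  have hs1 : Small.{max u w} (Pt.B ⧸ N) := by
    haveI : Small.{max u w} (X → ℝ) := small_max.{w} _
    refine small_of_injective (f := N.liftQ A le_rfl) ?_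
    rw [← LinearMap.ker_eq_bot]
    exact Submodule.ker_liftQ_eq_bot _ _ _ le_rfl
  have hs2 : Small.{max u w} D := by
    haveI : Small.{max u w} (Ω2 → ℝ) := small_max.{u} _
    exact small_of_injective (f := fun q : D => Pt.evBd q) (tdi.comp Subtype.val_injective)
  obtain ⟨B', iB1, iB2, iB3, ⟨eB⟩⟩ := exists_shrink_aux hs1
  obtain ⟨D', iD1, iD2, iD3, ⟨eD⟩⟩ := exists_shrink_aux hs2
  let π : Pt.B →ₗ[ℝ] B' := eB.symm.toLinearEquiv.toLinearMap.comp N.mkQ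
  have hπ : ∀ h, π h = eB.symm (Submodule.Quotient.mk h) := fun h => rfl
  have hπs : Function.Surjective π := eB.symm.surjective.comp N.mkQ_surjective
  have hπker : ∀ h, π h = 0 → h ∈ N := fun h hh => by
    rw [hπ] at hh
    simpa using hh
  have hπker' : ∀ h ∈ N, π h = 0 := fun h hh => by
    rw [hπ, (Submodule.Quotient.mk_eq_zero N).2 hh, map_zero]
  have hπn : ∀ h, ‖π h‖ ≤ ‖h‖ := fun h => by
    rw [hπ, LinearIsometryEquiv.norm_map]
    exact Submodule.Quotient.norm_mk_le N h
  have hπe : ∀ (f : B') (ε : ℝ), 0 < ε → ∃ h, π h = f ∧ ‖h‖ < ‖f‖ + ε := fun f ε hε => by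
    obtain ⟨h, h1, h2⟩ := Submodule.Quotient.norm_mk_lt (eB f) hε
    refine ⟨h, ?_, ?_⟩
    · rw [hπ, h1, LinearIsometryEquiv.symm_apply_apply]
    · rwa [LinearIsometryEquiv.norm_map] at h2
  let ι : D' →ₗ[ℝ] Pt.Bd := D.subtype.comp eD.toLinearEquiv.toLinearMap
  have hιn : ∀ g, ‖ι g‖ = ‖g‖ := fun g => eD.norm_map g
  have hιi : Function.Injective ι := Subtype.val_injective.comp eD.injective
  have hιD : ∀ g, ι g ∈ D := fun g => (eD g).2
  have hιs : ∀ q ∈ D, ∃ g, ι g = q := fun q hq => ⟨eD.symm ⟨q, hq⟩, by simp [ι]⟩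
  obtain ⟨s, hs⟩ := π.exists_rightInverse_of_surjective (LinearMap.range_eq_top.2 hπs)
  have hs' : ∀ f, π (s f) = f := fun f => LinearMap.congr_fun hs f
  have hsN : ∀ h, s (π h) - h ∈ N := fun h => hπker _ (by rw [map_sub, hs', sub_self])
  have hAs : ∀ h, A (s (π h)) = A h := fun h => by
    have := hsN h
    rwa [LinearMap.mem_ker, map_sub, sub_eq_zero] at this
  have hds : ∀ g h, Pt.dpair (ι g) (s (π h)) = Pt.dpair (ι g) h := fun g h => by
    have := hιD g _ (hsN h)
    rwa [map_sub, sub_eq_zero] at this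
  have hAinj : ∀ f h, A (s f) = A h → f = π h := fun f h hh => by
    have : s f - h ∈ N := by rw [LinearMap.mem_ker, map_sub, sub_eq_zero]; exact hh
    have := hπker' _ this
    rwa [map_sub, hs', sub_eq_zero] at this
  have hKD : ∀ x, Ktx (Kx1 x) ∈ D := fun x h hh => by
    rw [hKt.reproB]
    exact congrFun (LinearMap.mem_ker.1 hh) x
  choose kx hkx using fun x => hιs _ (hKD x)
  let P2 : RKBSPair.{u, w} X Ω2 :=
    { B := B', Bd := D', evB := A.comp s, evBd := Pt.evBd.comp ι
      dpair := (Pt.dpair.comp ι).compl₂ s }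
  have key : ∀ (f : B') (c M : ℝ), 0 ≤ M → (∀ h, π h = f → |c| ≤ M * ‖h‖) → |c| ≤ M * ‖f‖ := by
    intro f c M hM H
    refine le_of_forall_pos_le_add fun ε hε => ?_
    have hM1 : 0 < M + 1 := by linarith
    obtain ⟨h, h1, h2⟩ := hπe f (ε / (M + 1)) (by positivity)
    have h3 : M * (ε / (M + 1)) ≤ ε := by
      rw [← mul_div_assoc, div_le_iff₀ hM1]
      nlinarith
    have h4 := mul_le_mul_of_nonneg_left h2.le hM
    have := H h h1
    linarith
  have hrep : ∀ (f : B') (x : X), Pt.dpair (ι (kx x)) (s f) = A (s f) x := fun f x => by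
    rw [hkx, hKt.reproB]
    rfl
  refine ⟨P2, ⟨?_, ?_, ?_, ?_, ?_⟩, ⟨?_, ?_, ?_, ?_, ?_, ?_, ?_⟩, kx, fun w => π (Ktw w),
    ⟨?_, ?_, ?_, ?_⟩⟩
  · ext f
    constructor
    · rintro ⟨b, rfl⟩
      exact ⟨s b, rfl⟩
    · rintro ⟨h, rfl⟩
      exact ⟨π h, hAs h⟩
  · intro f
    change B' at f
    refine le_antisymm ?_ ?_
    · refine le_csInf ⟨_, s f, rfl, rfl⟩ ?_
      rintro r ⟨h, hh, rfl⟩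
      have := hAinj f h hh
      subst this
      exact hπn h
    · refine le_of_forall_pos_le_add fun ε hε => ?_
      obtain ⟨h, rfl, h2⟩ := hπe f ε hε
      refine le_trans (csInf_le ⟨0, ?_⟩ ⟨h, hAs h, rfl⟩) h2.le
      rintro r ⟨h, -, rfl⟩
      exact norm_nonneg h
  · ext g
    constructor
    · rintro ⟨b, rfl⟩
      exact ⟨ι b, fun h hh => hιD b h (funext hh), rfl⟩
    · rintro ⟨q, hq, rfl⟩
      obtain ⟨g, rfl⟩ := hιs q fun h hh => hq h fun x => congrFun (LinearMap.mem_ker.1 hh) x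
      exact ⟨g, rfl⟩
  · intro g q hq
    have : q = ι g := tdi hq
    subst this
    exact (hιn g).symm
  · intro g q f h hq hf
    have : q = ι g := tdi hq
    subst this
    have : f = π h := hAinj f h hf
    subst this
    exact hds g h
  · intro f f' hff
    exact (hAinj f (s f') hff).trans (hs' f')
  · exact tdi.comp hιi
  · intro x
    obtain ⟨C, hC, hCb⟩ := tb (Kx1 x)
    refine ⟨C, hC, fun f => key f _ C hC.le ?_⟩
    rintro h rfl
    exact (congrArg abs (congrFun (hAs h) x)).trans_le (hCb h)
  · intro w
    obtain ⟨C, hC, hCb⟩ := tdb w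
    exact ⟨C, hC, fun g => (hCb (ι g)).trans_eq (congrArg (C * ·) (hιn g))⟩
  · intro g f
    rw [mul_comm]
    refine key f _ _ (norm_nonneg g) ?_
    rintro h rfl
    refine (congrArg abs (hds g h)).trans_le ((tp _ _).trans_eq ?_)
    rw [hιn, mul_comm]
  · intro g hg
    refine hιi ((tn1 _ fun h => ?_).trans (map_zero ι).symm)
    exact (hds g h).symm.trans (hg (π h))
  · intro f hf
    refine (hAinj f 0 ?_).trans (map_zero π)
    rw [map_zero]
    funext x
    exact (hrep f x).symm.trans (hf (kx x))
  · intro x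
    exact (congrArg Pt.evBd (hkx x)).trans (hKt.evKx _)
  · intro w
    refine (hAs (Ktw w)).trans ?_
    rw [hA, hKt.evKw]
  · exact fun f x => hrep f x
  · intro g w
    exact (hds g _).trans (hKt.reproBd _ _)

end
end

section
/- Let L, d⁰ ∈ ℕ and let (B^L, B^{L⋄}) be the neural cRKBS pair of depth L on X ⊆ ℝ^{d⁰} with Ω¹ = ℝ^{d⁰} × ℝ, Ω^ℓ = B^{ℓ-1} × ℝ for ℓ = 2,…,L, activation functions σ^ℓ and weighting functions β^ℓ. Let d^ℓ ∈ ℕ, weight matrices W^ℓ ∈ ℝ^{d^{ℓ+1}×d^ℓ} for ℓ = 0,…,L-1, bias vectors b^ℓ ∈ ℝ^{d^ℓ} for ℓ = 1,…,L, and a row vector W^L ∈ ℝ^{1×d^L}. If f : X → ℝ is the deep neural network f(x) = W^L σ̂^L(b^L + W^{L-1} σ̂^{L-1}(⋯ σ̂¹(b¹ + W⁰x) ⋯)), where σ̂^ℓ is the elementwise extension of σ^ℓ, then f ∈ B^L and ‖f‖_{B^L} ≤ Σ_{j=1}^{d^L} |W^L_{1j}| / β^L(f_j^{L-1}, b^L_j),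 where f_j^{L-1}(x) = W^{L-1}_{j·} σ̂^{L-1}(⋯ σ̂¹(b¹ + W⁰x) ⋯) with W^{L-1}_{j·} the j-th row of W^{L-1}. -/
/-!
STATEMENT 9: Every deep neural network
f(x) = W^L σ̂^L(b^L + W^{L-1} σ̂^{L-1}(⋯ σ̂¹(b¹ + W⁰x) ⋯)) belongs to the neural cRKBS
B^L of depth L on X ⊆ ℝ^{d⁰} (with Ω¹ = ℝ^{d⁰} × ℝ and Ω^ℓ = B^{ℓ-1} × ℝ), and
‖f‖_{B^L} ≤ Σ_j |W^L_{1j}| / β^L(f_j^{L-1}, b^L_j).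
Here the depth is L = M + 1.
-/

noncomputable section

open MeasureTheory in
/-- The integral of `f` against a (finite) signed measure, via the Jordan decomposition. -/
noncomputable def sint {α : Type*} [MeasurableSpace α] (μ : SignedMeasure α)
    (f : α → ℝ) : ℝ :=
  ∫ a, f a ∂μ.toJordanDecomposition.posPart - ∫ a, f a ∂μ.toJordanDecomposition.negPart

open MeasureTheory in
/-- A (finite) signed measure is Radon if its total variation is a regular measure. -/
def IsRadonSM {α : Type*} [TopologicalSpace α] [MeasurableSpace α]
    (μ : SignedMeasure α) : Prop :=
  μ.totalVariation.Regular

open MeasureTheory in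
/-- The total variation norm `|μ|(univ)` of a signed measure. -/
noncomputable def tvnorm {α : Type*} [MeasurableSpace α] (μ : SignedMeasure α) : ℝ :=
  (μ.totalVariation Set.univ).toReal

open MeasureTheory in
/-- The functions `x ↦ ∫ φ(x,w) dμ(w)` for a finite signed Radon measure `μ`. -/
def intSet {D α : Type*} [TopologicalSpace α] [MeasurableSpace α]
    (φ : D → α → ℝ) : Set (D → ℝ) :=
  {f | ∃ μ : SignedMeasure α, IsRadonSM μ ∧ ∀ x, f x = sint μ (φ x)}

open MeasureTheory in
/-- The integral RKBS norm `inf {|μ|(Ω) : f = ∫ φ(·,w) dμ(w)}`. -/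
noncomputable def intNorm {D α : Type*} [TopologicalSpace α] [MeasurableSpace α]
    (φ : D → α → ℝ) (f : D → ℝ) : ℝ :=
  sInf {r | ∃ μ : SignedMeasure α, IsRadonSM μ ∧ (∀ x, f x = sint μ (φ x)) ∧ r = tvnorm μ}

open MeasureTheory in
/-- The functions `w ↦ ∫ φ(x,w) dρ(x)` for a finite signed Radon measure `ρ`. -/
def dualSet {D α : Type*} [TopologicalSpace D] [MeasurableSpace D]
    (φ : D → α → ℝ) : Set (α → ℝ) :=
  {g | ∃ ρ : SignedMeasure D, IsRadonSM ρ ∧ ∀ w, g w = sint ρ (fun x => φ x w)}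

open MeasureTheory in
/-- The pairing `∫∫ φ d(ρ × μ)` of two signed measures, via Jordan decompositions. -/
noncomputable def pairInt {X Ω : Type*} [MeasurableSpace X] [MeasurableSpace Ω]
    (φ : X → Ω → ℝ) (ρ : SignedMeasure X) (μ : SignedMeasure Ω) : ℝ :=
  ∫ p, φ p.1 p.2 ∂(ρ.toJordanDecomposition.posPart.prod μ.toJordanDecomposition.posPart)
  + ∫ p, φ p.1 p.2 ∂(ρ.toJordanDecomposition.negPart.prod μ.toJordanDecomposition.negPart)
  - ∫ p, φ p.1 p.2 ∂(ρ.toJordanDecomposition.posPart.prod μ.toJordanDecomposition.negPart)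
  - ∫ p, φ p.1 p.2 ∂(ρ.toJordanDecomposition.negPart.prod μ.toJordanDecomposition.posPart)

/-- The topology generated by the balls of a (norm-like) functional `n`; for a genuine
norm this is the norm topology. -/
def topOfNorm {α : Type*} [Sub α] (n : α → ℝ) : TopologicalSpace α :=
  TopologicalSpace.generateFrom {s | ∃ f ε, 0 < ε ∧ s = {g | n (g - f) < ε}}

/-- The neural chain of integral RKBSs on `X ⊆ ℝ^{d⁰}` (primal side), described
concretely:  `chainB … ℓ` is the pair (set of functions of `B^{ℓ+1}`, norm of
`B^{ℓ+1}`).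
* level 1:  `B¹` is the integral RKBS on `X` with parameter set `Ω¹ = S1 ⊆ ℝ^{d⁰} × ℝ`
  and neural kernel `φ¹(x,(v,b)) = σ¹(⟨v,x⟩+b)·β¹(v,b)`;
* level ℓ+1:  `B^{ℓ+1}` is the integral RKBS on `X` with parameter set
  `Ω^{ℓ+1} = Ss (ℓ+1) ⊆ B^ℓ × ℝ` and neural kernel
  `φ^{ℓ+1}(x,(f,b)) = σ^{ℓ+1}(f(x)+b)·β^{ℓ+1}(f,b)`, where `B^ℓ × ℝ` carries (the
  Borel σ-algebra of) the topology of the `B^ℓ`-norm.  -/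
def chainB (d0 : ℕ) (X : Set (Fin d0 → ℝ)) (σ : ℕ → ℝ → ℝ)
    (β1 : ((Fin d0 → ℝ) × ℝ) → ℝ) (βs : ℕ → ((↥X → ℝ) × ℝ) → ℝ)
    (S1 : Set ((Fin d0 → ℝ) × ℝ)) (Ss : ℕ → Set ((↥X → ℝ) × ℝ)) :
    ℕ → Set (↥X → ℝ) × ((↥X → ℝ) → ℝ)
  | 0 =>
      (intSet (fun (x : ↥X) (w : ↥S1) =>
          σ 1 ((∑ n, w.val.1 n * (x : Fin d0 → ℝ) n) + w.val.2) * β1 w.val),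
       intNorm (fun (x : ↥X) (w : ↥S1) =>
          σ 1 ((∑ n, w.val.1 n * (x : Fin d0 → ℝ) n) + w.val.2) * β1 w.val))
  | (ℓ+1) =>
      letI : TopologicalSpace (↥X → ℝ) := topOfNorm (chainB d0 X σ β1 βs S1 Ss ℓ).2
      letI : MeasurableSpace (↥X → ℝ) := borel _
      (intSet (fun (x : ↥X) (w : ↥(Ss (ℓ+2))) =>
          σ (ℓ+2) (w.val.1 x + w.val.2) * βs (ℓ+2) w.val),
       intNorm (fun (x : ↥X) (w : ↥(Ss (ℓ+2))) =>
          σ (ℓ+2) (w.val.1 x + w.val.2) * βs (ℓ+2) w.val))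

/-- The Borel σ-algebra on `B^{ℓ} × ℝ ⊆ (X → ℝ) × ℝ` induced by the `B^ℓ`-norm
topology (used to express measurability of the weighting functions `β^{ℓ+1}`). -/
def levelMeas (d0 : ℕ) (X : Set (Fin d0 → ℝ)) (σ : ℕ → ℝ → ℝ)
    (β1 : ((Fin d0 → ℝ) × ℝ) → ℝ) (βs : ℕ → ((↥X → ℝ) × ℝ) → ℝ)
    (S1 : Set ((Fin d0 → ℝ) × ℝ)) (Ss : ℕ → Set ((↥X → ℝ) × ℝ)) (ℓ : ℕ) :
    MeasurableSpace ((↥X → ℝ) × ℝ) :=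
  MeasurableSpace.prod (@borel _ (topOfNorm (chainB d0 X σ β1 βs S1 Ss ℓ).2))
    Real.measurableSpace

/-- Pre-activations of a deep fully connected network with layer widths `d`:
`preactV σ d W bv x ℓ` is the input (before adding the bias `bv (ℓ+1)` and applying
`σ (ℓ+1)`) of hidden layer `ℓ+1` on input `x`, so that
`preactV σ d W bv x 0 = W⁰x` and
`preactV σ d W bv x (ℓ+1) = W^{ℓ+1}·σ̂^{ℓ+1}(b^{ℓ+1} + preactV σ d W bv x ℓ)`. -/
def preactV (σ : ℕ → ℝ → ℝ) (d : ℕ → ℕ)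
    (W : ∀ ℓ : ℕ, Fin (d (ℓ+1)) → Fin (d ℓ) → ℝ) (bv : ∀ ℓ : ℕ, Fin (d ℓ) → ℝ)
    (x : Fin (d 0) → ℝ) : (ℓ : ℕ) → Fin (d (ℓ+1)) → ℝ
  | 0 => fun j => ∑ n, W 0 j n * x n
  | (ℓ+1) => fun j => ∑ k, W (ℓ+1) j k * σ (ℓ+1) (bv (ℓ+1) k + preactV σ d W bv x ℓ k)

/-- The denominator `β^L(f_j^{L-1}, b^L_j)` appearing in the norm bound of the deep
network embedding theorem, for depth `L = M + 1`: for `L = 1` it is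
`β¹(W⁰_{j·}, b¹_j)`, and for `L ≥ 2` it is `β^L(f_j^{L-1}, b^L_j)` where
`f_j^{L-1}(x) = W^{L-1}_{j·} σ̂^{L-1}(⋯ σ̂¹(b¹ + W⁰x) ⋯) = (preactV … x (L-1))_j`. -/
def denomV (d : ℕ → ℕ) (X : Set (Fin (d 0) → ℝ)) (σ : ℕ → ℝ → ℝ)
    (W : ∀ ℓ : ℕ, Fin (d (ℓ+1)) → Fin (d ℓ) → ℝ) (bv : ∀ ℓ : ℕ, Fin (d ℓ) → ℝ)
    (β1 : ((Fin (d 0) → ℝ) × ℝ) → ℝ) (βs : ℕ → ((↥X → ℝ) × ℝ) → ℝ) :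
    (M : ℕ) → Fin (d (M+1)) → ℝ
  | 0, j => β1 (W 0 j, bv 1 j)
  | (m+1), j =>
      βs (m+2) ((fun x : ↥X => preactV σ d W bv (x : Fin (d 0) → ℝ) (m+1) j), bv (m+2) j)

section helpers
open MeasureTheory

theorem h_reg_of_le {α : Type*} [TopologicalSpace α] [MeasurableSpace α]
    [OpensMeasurableSpace α] [T2Space α] (τ ρ : Measure α) [IsFiniteMeasure ρ]
    [IsFiniteMeasure τ] (hρ : ρ.Regular) (hle : τ ≤ ρ) : τ.Regular := by
  refine { lt_top_of_isCompact := fun K _ => measure_lt_top _ _, outerRegular := ?_,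
           innerRegular := ?_ }
  · intro A hA r hr
    have h0 : r - τ A ≠ 0 := (tsub_pos_of_lt hr).ne'
    obtain ⟨U, hAU, hU, hlt⟩ := hA.exists_isOpen_sdiff_lt (measure_ne_top ρ A) h0
    refine ⟨U, hAU, hU, ?_⟩
    calc τ U = τ A + τ (U \ A) := by
            rw [← measure_inter_add_sdiff U hA, Set.inter_eq_self_of_subset_right hAU]
      _ ≤ τ A + ρ (U \ A) := by gcongr
      _ < τ A + (r - τ A) := by
            exact ENNReal.add_lt_add_left (measure_ne_top τ A) hlt.2
      _ = r := add_tsub_cancel_of_le hr.le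
  · intro U hU r hr
    have h0 : τ U - r ≠ 0 := (tsub_pos_of_lt hr).ne'
    obtain ⟨K, hKU, hK, hlt⟩ := hU.measurableSet.exists_isCompact_sdiff_lt
      (measure_ne_top ρ U) h0
    refine ⟨K, hKU, hK, ?_⟩
    by_contra hcon
    push Not at hcon
    have : τ U < τ U := by
      calc τ U = τ K + τ (U \ K) := by
            rw [← measure_inter_add_sdiff U hK.measurableSet,
              Set.inter_eq_self_of_subset_right hKU]
        _ ≤ r + ρ (U \ K) := by gcongr
        _ < r + (τ U - r) := ENNReal.add_lt_add_left (hr.trans_le le_top).ne hlt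
        _ = τ U := add_tsub_cancel_of_le hr.le
    exact lt_irrefl _ this

theorem h_reg_add {α : Type*} [TopologicalSpace α] [MeasurableSpace α]
    [OpensMeasurableSpace α] [T2Space α] (τ ρ : Measure α) [IsFiniteMeasure ρ]
    [IsFiniteMeasure τ] (hρ : ρ.Regular) (hτ : τ.Regular) : (τ + ρ).Regular := by
  refine { lt_top_of_isCompact := fun K _ => measure_lt_top _ _, outerRegular := ?_,
           innerRegular := ?_ }
  · intro A hA r hr
    have h0 : (r - (τ + ρ) A) / 2 ≠ 0 :=
      (ENNReal.half_pos (tsub_pos_of_lt hr).ne').ne'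
    obtain ⟨U, hAU, hU, hlt⟩ := A.exists_isOpen_le_add ρ h0
    obtain ⟨V, hAV, hV, hlt'⟩ := A.exists_isOpen_lt_add (measure_ne_top τ A) h0
    refine ⟨U ∩ V, Set.subset_inter hAU hAV, hU.inter hV, ?_⟩
    calc (τ + ρ) (U ∩ V) ≤ τ V + ρ U := by
            rw [Measure.add_apply]; gcongr <;> simp
      _ < (τ A + (r - (τ + ρ) A) / 2) + (ρ A + (r - (τ + ρ) A) / 2) :=
            ENNReal.add_lt_add_of_lt_of_le (measure_ne_top _ _) hlt' hlt
      _ = (τ + ρ) A + (r - (τ + ρ) A) := by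
            rw [Measure.add_apply]
            conv_rhs => rw [← ENNReal.add_halves (r - (τ A + ρ A))]
            ring
      _ = r := add_tsub_cancel_of_le hr.le
  · intro U hU r hr
    have h0 : ((τ + ρ) U - r) / 2 ≠ 0 :=
      (ENNReal.half_pos (tsub_pos_of_lt hr).ne').ne'
    obtain ⟨K, hKU, hK, hlt⟩ := hU.measurableSet.exists_isCompact_lt_add
      (measure_ne_top ρ U) h0
    obtain ⟨K', hKU', hK', hlt'⟩ := hU.measurableSet.exists_isCompact_lt_add
      (measure_ne_top τ U) h0
    refine ⟨K ∪ K', Set.union_subset hKU hKU', hK.union hK', ?_⟩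
    by_contra hcon
    push Not at hcon
    have : (τ + ρ) U < (τ + ρ) U := by
      calc (τ + ρ) U = τ U + ρ U := by rw [Measure.add_apply]
        _ < (τ K' + ((τ + ρ) U - r) / 2) + (ρ K + ((τ + ρ) U - r) / 2) :=
            ENNReal.add_lt_add hlt' hlt
        _ = (τ K' + ρ K) + ((τ + ρ) U - r) := by
            conv_rhs => rw [← ENNReal.add_halves ((τ + ρ) U - r)]
            ring
        _ ≤ (τ + ρ) (K ∪ K') + ((τ + ρ) U - r) := by
            rw [Measure.add_apply _ _ (K ∪ K')]; gcongr <;> simp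
        _ ≤ r + ((τ + ρ) U - r) := by gcongr
        _ = (τ + ρ) U := add_tsub_cancel_of_le hr.le
    exact lt_irrefl _ this

theorem h_reg_dirac {α : Type*} [TopologicalSpace α] [MeasurableSpace α]
    [OpensMeasurableSpace α] [T2Space α] (a : α) : (Measure.dirac a).Regular := by
  refine { lt_top_of_isCompact := fun K _ => measure_lt_top _ _, outerRegular := ?_,
           innerRegular := ?_ }
  · intro A hA r hr
    by_cases ha : a ∈ A
    · refine ⟨Set.univ, Set.subset_univ _, isOpen_univ, ?_⟩
      rw [Measure.dirac_apply' _ hA] at hr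
      simpa [ha] using hr
    · refine ⟨{a}ᶜ, by simpa using ha, isOpen_compl_singleton, ?_⟩
      rw [Measure.dirac_apply' _ hA] at hr
      simpa [ha] using hr
  · intro U hU r hr
    rw [Measure.dirac_apply' _ hU.measurableSet] at hr
    by_cases ha : a ∈ U
    · exact ⟨{a}, by simpa using ha, isCompact_singleton, by simpa [ha] using hr⟩
    · simp [ha] at hr

theorem h_reg_sum {α : Type*} [TopologicalSpace α] [MeasurableSpace α]
    [OpensMeasurableSpace α] [T2Space α] {k : ℕ} (w : Fin k → α) (c : Fin k → NNReal) :
    (∑ j, c j • Measure.dirac (w j)).Regular := by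
  suffices h : ∀ s : Finset (Fin k), (∑ j ∈ s, c j • Measure.dirac (w j)).Regular ∧
      IsFiniteMeasure (∑ j ∈ s, c j • Measure.dirac (w j)) from (h _).1
  intro s
  induction s using Finset.induction_on with
  | empty => simp only [Finset.sum_empty]; exact ⟨inferInstance, inferInstance⟩
  | insert a s ha ih =>
    rw [Finset.sum_insert ha]
    haveI := ih.2
    haveI := h_reg_dirac (w a)
    exact ⟨h_reg_add _ _ ih.1 inferInstance, inferInstance⟩

theorem h_int {α : Type*} [MeasurableSpace α] (p : Measure α) [IsFiniteMeasure p]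
    (f : α → ℝ) (hf : Measurable f) (C : ℝ) (hC : ∀ a, |f a| ≤ C) : Integrable f p :=
  Integrable.of_bound hf.aestronglyMeasurable C (Filter.Eventually.of_forall hC)

/-- Signed measures given as a difference. -/
theorem h_decomp {α : Type*} [MeasurableSpace α]
    (p q : Measure α) [IsFiniteMeasure p] [IsFiniteMeasure q] :
    ((p.toSignedMeasure - q.toSignedMeasure).toJordanDecomposition.posPart + q =
      p + (p.toSignedMeasure - q.toSignedMeasure).toJordanDecomposition.negPart) := by
  have h := SignedMeasure.toSignedMeasure_toJordanDecomposition
    (p.toSignedMeasure - q.toSignedMeasure)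
  rw [JordanDecomposition.toSignedMeasure] at h
  rw [← Measure.toSignedMeasure_eq_toSignedMeasure_iff, Measure.toSignedMeasure_add,
    Measure.toSignedMeasure_add]
  rwa [sub_eq_sub_iff_add_eq_add] at h

theorem h_le_aux {α : Type*} [MeasurableSpace α]
    (P N p q : Measure α) (hs : P.MutuallySingular N) (h : P + q = p + N) : P ≤ p := by
  obtain ⟨s, hsm, h1, h2⟩ := hs
  refine Measure.le_intro fun A hA _ => ?_
  calc P A = P (A ∩ sᶜ) := by
        rw [← measure_inter_add_sdiff A hsm, measure_mono_null Set.inter_subset_right h1,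
          zero_add]; rfl
    _ ≤ (P + q) (A ∩ sᶜ) := by simp
    _ = p (A ∩ sᶜ) + N (A ∩ sᶜ) := by rw [h]; rfl
    _ = p (A ∩ sᶜ) := by rw [measure_mono_null Set.inter_subset_right h2, add_zero]
    _ ≤ p A := measure_mono Set.inter_subset_left

theorem h_tv_le {α : Type*} [MeasurableSpace α]
    (p q : Measure α) [IsFiniteMeasure p] [IsFiniteMeasure q] :
    (p.toSignedMeasure - q.toSignedMeasure).totalVariation ≤ p + q := by
  have h := h_decomp p q
  have hs := (p.toSignedMeasure - q.toSignedMeasure).toJordanDecomposition.mutuallySingular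
  refine add_le_add (h_le_aux _ _ _ _ hs h) (h_le_aux _ _ q p hs.symm ?_)
  rw [add_comm, ← h, add_comm]

theorem h_sint {α : Type*} [MeasurableSpace α]
    (p q : Measure α) [IsFiniteMeasure p] [IsFiniteMeasure q]
    (f : α → ℝ) (hf : Measurable f) (C : ℝ) (hC : ∀ a, |f a| ≤ C) :
    sint (p.toSignedMeasure - q.toSignedMeasure) f = ∫ a, f a ∂p - ∫ a, f a ∂q := by
  have h := congrArg (fun m => ∫ a, f a ∂m) (h_decomp p q)
  rw [integral_add_measure (h_int _ f hf C hC) (h_int _ f hf C hC),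
    integral_add_measure (h_int _ f hf C hC) (h_int _ f hf C hC)] at h
  unfold sint
  linarith

theorem h_sint_le {α : Type*} [MeasurableSpace α] (μ : SignedMeasure α)
    (f : α → ℝ) (C : ℝ) (hC : ∀ a, |f a| ≤ C) :
    |sint μ f| ≤ C * tvnorm μ := by
  unfold sint tvnorm SignedMeasure.totalVariation
  have h1 := norm_integral_le_of_norm_le_const (f := f) (C := C)
    (μ := μ.toJordanDecomposition.posPart) (Filter.Eventually.of_forall hC)
  have h2 := norm_integral_le_of_norm_le_const (f := f) (C := C)
    (μ := μ.toJordanDecomposition.negPart) (Filter.Eventually.of_forall hC)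
  rw [Measure.add_apply, ENNReal.toReal_add (measure_ne_top _ _) (measure_ne_top _ _)]
  simp only [Real.norm_eq_abs, measureReal_def] at h1 h2
  refine (abs_sub _ _).trans ?_
  linarith

/-- What we need to know about one level. -/
structure HGood {D : Type*} (B : Set (D → ℝ)) (n : (D → ℝ) → ℝ) : Prop where
  zero_norm : n 0 = 0
  sub_mem : ∀ f ∈ B, ∀ g ∈ B, f - g ∈ B
  bound : ∃ C, 0 ≤ C ∧ ∀ f ∈ B, ∀ x, |f x| ≤ C * n f

theorem h_mem_le {D α : Type*} [TopologicalSpace α] [MeasurableSpace α]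
    [OpensMeasurableSpace α] [T2Space α] (φ : D → α → ℝ) (hφ : ∀ x, Measurable (φ x))
    (C : ℝ) (hC : ∀ x a, |φ x a| ≤ C) (p q : Measure α) [IsFiniteMeasure p]
    [IsFiniteMeasure q] (hp : p.Regular) (hq : q.Regular) (f : D → ℝ)
    (hf : ∀ x, f x = ∫ a, φ x a ∂p - ∫ a, φ x a ∂q) :
    f ∈ intSet φ ∧ intNorm φ f ≤ ((p + q) Set.univ).toReal := by
  have hR : IsRadonSM (p.toSignedMeasure - q.toSignedMeasure) :=
    h_reg_of_le _ _ (h_reg_add p q hq hp) (h_tv_le p q)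
  have hx : ∀ x, f x = sint (p.toSignedMeasure - q.toSignedMeasure) (φ x) := fun x => by
    rw [hf x, h_sint p q _ (hφ x) C (hC x)]
  refine ⟨⟨_, hR, hx⟩, ?_⟩
  refine le_trans (csInf_le ⟨0, ?_⟩ ⟨_, hR, hx, rfl⟩) ?_
  · rintro r ⟨μ, _, _, rfl⟩
    exact ENNReal.toReal_nonneg
  · exact ENNReal.toReal_mono (measure_ne_top _ _) (h_tv_le p q _)

theorem h_good {D α : Type*} [TopologicalSpace α] [MeasurableSpace α]
    [OpensMeasurableSpace α] [T2Space α] (φ : D → α → ℝ) (hφ : ∀ x, Measurable (φ x))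
    (hb : ∃ C, ∀ x a, |φ x a| ≤ C) : HGood (intSet φ) (intNorm φ) := by
  obtain ⟨C, hC⟩ := hb
  refine ⟨?_, ?_, max C 0, le_max_right _ _, ?_⟩
  · refine le_antisymm ?_ ?_
    · simpa using (h_mem_le φ hφ C hC 0 0 inferInstance inferInstance 0 (by simp)).2
    · refine Real.sInf_nonneg ?_
      rintro r ⟨μ, _, _, rfl⟩
      exact ENNReal.toReal_nonneg
  · rintro f ⟨μ, hμ, hf⟩ g ⟨ν, hν, hg⟩
    have r1 : μ.toJordanDecomposition.posPart.Regular :=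
      h_reg_of_le _ _ hμ (Measure.le_add_right le_rfl)
    have r2 : μ.toJordanDecomposition.negPart.Regular :=
      h_reg_of_le _ _ hμ (Measure.le_add_left le_rfl)
    have r3 : ν.toJordanDecomposition.posPart.Regular :=
      h_reg_of_le _ _ hν (Measure.le_add_right le_rfl)
    have r4 : ν.toJordanDecomposition.negPart.Regular :=
      h_reg_of_le _ _ hν (Measure.le_add_left le_rfl)
    refine (h_mem_le φ hφ C hC
      (μ.toJordanDecomposition.posPart + ν.toJordanDecomposition.negPart)
      (μ.toJordanDecomposition.negPart + ν.toJordanDecomposition.posPart)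
      (h_reg_add _ _ r4 r1) (h_reg_add _ _ r3 r2) (f - g) ?_).1
    intro x
    rw [integral_add_measure (h_int _ _ (hφ x) C (hC x)) (h_int _ _ (hφ x) C (hC x)),
      integral_add_measure (h_int _ _ (hφ x) C (hC x)) (h_int _ _ (hφ x) C (hC x)),
      Pi.sub_apply, hf x, hg x]
    unfold sint
    ring
  · rintro f ⟨μ, hμ, hf⟩ x
    have key : ∀ r ∈ {r | ∃ μ : SignedMeasure α, IsRadonSM μ ∧
        (∀ x, f x = sint μ (φ x)) ∧ r = tvnorm μ}, |f x| ≤ max C 0 * r := by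
      rintro r ⟨ν, _, h, rfl⟩
      rw [h x]
      exact h_sint_le _ _ _ fun a => (hC x a).trans (le_max_left _ _)
    rcases (le_max_right C 0).eq_or_lt with h0 | h0
    · have := key _ ⟨μ, hμ, hf, rfl⟩
      rw [← h0] at this ⊢
      simpa using this
    · rw [← div_le_iff₀' h0]
      refine le_csInf ⟨_, μ, hμ, hf, rfl⟩ fun r hr => ?_
      rw [div_le_iff₀' h0]
      exact key r hr

theorem h_net {D α : Type*} [TopologicalSpace α] [MeasurableSpace α]
    [OpensMeasurableSpace α] [T2Space α] (φ : D → α → ℝ) (hφ : ∀ x, Measurable (φ x))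
    (hb : ∃ C, ∀ x a, |φ x a| ≤ C) {k : ℕ} (w : Fin k → α) (c : Fin k → ℝ) (f : D → ℝ)
    (hf : ∀ x, f x = ∑ j, c j * φ x (w j)) :
    f ∈ intSet φ ∧ intNorm φ f ≤ ∑ j, |c j| := by
  obtain ⟨C, hC⟩ := hb
  have hI : ∀ (e : Fin k → NNReal) x, ∫ a, φ x a ∂(∑ j, e j • Measure.dirac (w j))
      = ∑ j, (e j : ℝ) * φ x (w j) := by
    intro e x
    rw [integral_finsetSum_measure fun j _ => h_int _ _ (hφ x) C (hC x)]
    refine Finset.sum_congr rfl fun j _ => ?_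
    rw [integral_smul_nnreal_measure,
      integral_dirac' _ _ (hφ x).stronglyMeasurable]
    rfl
  have := h_mem_le φ hφ C hC (∑ j, (c j).toNNReal • Measure.dirac (w j))
    (∑ j, (-c j).toNNReal • Measure.dirac (w j)) (h_reg_sum _ _) (h_reg_sum _ _) f ?_
  · refine ⟨this.1, this.2.trans (le_of_eq ?_)⟩
    rw [Measure.add_apply, Measure.finsetSum_apply, Measure.finsetSum_apply,
      ← Finset.sum_add_distrib, ENNReal.toReal_sum]
    · refine Finset.sum_congr rfl fun j _ => ?_
      simp only [Measure.smul_apply, measure_univ, ENNReal.smul_def, smul_eq_mul, mul_one]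
      rw [ENNReal.toReal_add ENNReal.coe_ne_top ENNReal.coe_ne_top,
        ENNReal.coe_toReal, ENNReal.coe_toReal, Real.coe_toNNReal', Real.coe_toNNReal']
      exact max_zero_add_max_neg_zero_eq_abs_self (c j)
    · intro j _
      exact ENNReal.add_ne_top.2 ⟨measure_ne_top _ _, measure_ne_top _ _⟩
  · intro x
    rw [hI, hI, hf x, ← Finset.sum_sub_distrib]
    refine Finset.sum_congr rfl fun j _ => ?_
    rw [← sub_mul, Real.coe_toNNReal', Real.coe_toNNReal', max_zero_sub_max_neg_zero_eq_self]

theorem h_eval_cont {D : Type*} (B : Set (D → ℝ)) (n : (D → ℝ) → ℝ) (hg : HGood B n)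
    (x : D) : letI : TopologicalSpace (D → ℝ) := topOfNorm n
    Continuous (fun f : ↥B => f.val x) := by
  letI : TopologicalSpace (D → ℝ) := topOfNorm n
  obtain ⟨C, hC0, hC⟩ := hg.bound
  rw [continuous_iff_continuousAt]
  intro f
  rw [ContinuousAt, Metric.tendsto_nhds]
  intro ε hε
  have hpos : 0 < ε / (C + 1) := by positivity
  have ho : IsOpen {g : D → ℝ | n (g - f.val) < ε / (C + 1)} :=
    TopologicalSpace.isOpen_generateFrom_of_mem ⟨f.val, _, hpos, rfl⟩
  have ho' := ho.preimage (continuous_subtype_val (p := fun g => g ∈ B))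
  filter_upwards [ho'.mem_nhds (x := f) (by simpa [hg.zero_norm] using hpos)] with g hgm
  have hgm' : n (g.val - f.val) < ε / (C + 1) := hgm
  have h1 := hC _ (hg.sub_mem _ g.2 _ f.2) x
  rw [Real.dist_eq]
  rw [lt_div_iff₀ (by positivity)] at hgm'
  have h2 : (0:ℝ) ≤ |(g.val - f.val) x| := abs_nonneg _
  simp only [Pi.sub_apply] at h1 h2
  by_cases h3 : 0 ≤ n (g.val - f.val)
  · nlinarith
  · nlinarith

theorem h_level {D : Type*} (B : Set (D → ℝ)) (n : (D → ℝ) → ℝ) (hg : HGood B n)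
    (S : Set ((D → ℝ) × ℝ)) (hS : S = B ×ˢ (Set.univ : Set ℝ)) (s : ℝ → ℝ)
    (hs : Measurable s) (b : ((D → ℝ) × ℝ) → ℝ)
    (hb : @Measurable _ _ ((MeasurableSpace.prod (@borel _ (topOfNorm n))
      Real.measurableSpace).comap (Subtype.val : ↥S → (D → ℝ) × ℝ)) _
      (fun w : ↥S => b w.val)) :
    letI : TopologicalSpace (D → ℝ) := topOfNorm n
    letI : MeasurableSpace (D → ℝ) := borel _
    T2Space ↥S ∧ OpensMeasurableSpace ↥S ∧
      ∀ x, Measurable (fun w : ↥S => s (w.val.1 x + w.val.2) * b w.val) := by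
  letI : TopologicalSpace (D → ℝ) := topOfNorm n
  letI : MeasurableSpace (D → ℝ) := borel _
  haveI : BorelSpace (D → ℝ) := ⟨rfl⟩
  have hm : ∀ w : ↥S, w.val.1 ∈ B := fun w => by
    have h1 : w.val ∈ B ×ˢ (Set.univ : Set ℝ) := hS.subset w.2
    exact h1.1
  have hc : ∀ x, Continuous (fun w : ↥S => w.val.1 x) := fun x =>
    (h_eval_cont B n hg x).comp
      (Continuous.subtype_mk (continuous_fst.comp continuous_subtype_val) hm)
  have hc2 : Continuous (fun w : ↥S => w.val.2) := continuous_snd.comp continuous_subtype_val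
  have hO : OpensMeasurableSpace ↥S := inferInstance
  refine ⟨?_, hO, fun x => ?_⟩
  · refine ⟨fun w w' hne => ?_⟩
    by_cases h2 : w.val.2 = w'.val.2
    · have : ∃ x, w.val.1 x ≠ w'.val.1 x := by
        by_contra hcon
        push Not at hcon
        exact hne (Subtype.ext (Prod.ext (funext hcon) h2))
      obtain ⟨x, hx⟩ := this
      exact separated_by_continuous (hc x) hx
    · exact separated_by_continuous hc2 h2
  · exact (hs.comp ((hc x).measurable.add hc2.measurable)).mul hb

end helpers

/-- Every deep neural network of depth `L = M+1` with layer widths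
`d`, weights `W`, biases `bv` and output weights `WL` is an element of the neural
cRKBS `B^L` (here `Ω¹ = ℝ^{d⁰} × ℝ` and `Ω^ℓ = B^{ℓ-1} × ℝ` are the full parameter
spaces), with `‖f‖_{B^L} ≤ Σ_j |W^L_{1j}| / β^L(f_j^{L-1}, b^L_j)`. -/
theorem statement9 (d : ℕ → ℕ) (X : Set (Fin (d 0) → ℝ)) (σ : ℕ → ℝ → ℝ)
    (β1 : ((Fin (d 0) → ℝ) × ℝ) → ℝ) (βs : ℕ → ((↥X → ℝ) × ℝ) → ℝ)
    (Ss : ℕ → Set ((↥X → ℝ) × ℝ))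
    -- Ω^{ℓ} = B^{ℓ-1} × ℝ for ℓ ≥ 2 (and Ω¹ = ℝ^{d⁰} × ℝ below):
    (hSs : ∀ ℓ : ℕ, Ss (ℓ+2) =
      (chainB (d 0) X σ β1 βs Set.univ Ss ℓ).1 ×ˢ (Set.univ : Set ℝ))
    -- the activation functions are measurable:
    (hσmeas : ∀ ℓ, Measurable (σ ℓ))
    -- the weighting functions are positive:
    (hβ1pos : ∀ w, 0 < β1 w) (hβspos : ∀ ℓ w, 0 < βs ℓ w)
    -- the weighting functions are (Borel) measurable:
    (hβ1meas : Measurable β1)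
    (hβsmeas : ∀ ℓ : ℕ, @Measurable _ _
      ((levelMeas (d 0) X σ β1 βs Set.univ Ss ℓ).comap
        (Subtype.val : ↥(Ss (ℓ+2)) → (↥X → ℝ) × ℝ)) _
      (fun w : ↥(Ss (ℓ+2)) => βs (ℓ+2) w.val))
    -- the kernels are bounded:
    (hbdd1 : ∃ C, ∀ (x : ↥X) (w : (Fin (d 0) → ℝ) × ℝ),
      |σ 1 ((∑ n, w.1 n * (x : Fin (d 0) → ℝ) n) + w.2) * β1 w| ≤ C)
    (hbdds : ∀ ℓ : ℕ, ∃ C, ∀ (x : ↥X), ∀ w ∈ Ss (ℓ+2),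
      |σ (ℓ+2) (w.1 x + w.2) * βs (ℓ+2) w| ≤ C)
    -- the network, of depth L = M+1:
    (L M : ℕ) (hL : L = M + 1)
    (W : ∀ ℓ : ℕ, Fin (d (ℓ+1)) → Fin (d ℓ) → ℝ)
    (bv : ∀ ℓ : ℕ, Fin (d ℓ) → ℝ)
    (WL : Fin (d (M+1)) → ℝ) :
    (fun x : ↥X => ∑ j, WL j *
        σ (M+1) (bv (M+1) j + preactV σ d W bv (x : Fin (d 0) → ℝ) M j))
      ∈ (chainB (d 0) X σ β1 βs Set.univ Ss M).1 ∧
    (chainB (d 0) X σ β1 βs Set.univ Ss M).2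
        (fun x : ↥X => ∑ j, WL j *
          σ (M+1) (bv (M+1) j + preactV σ d W bv (x : Fin (d 0) → ℝ) M j))
      ≤ ∑ j, |WL j| / denomV d X σ W bv β1 βs M j := by
  have hφ1 : ∀ x : ↥X, Measurable (fun w : ↥(Set.univ : Set ((Fin (d 0) → ℝ) × ℝ)) =>
      σ 1 ((∑ n, w.val.1 n * (x : Fin (d 0) → ℝ) n) + w.val.2) * β1 w.val) := by
    intro x
    refine Measurable.mul ((hσmeas 1).comp ?_) (hβ1meas.comp measurable_subtype_coe)
    fun_prop
  have hb1 : ∃ C, ∀ (x : ↥X) (w : ↥(Set.univ : Set ((Fin (d 0) → ℝ) × ℝ))),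
      |σ 1 ((∑ n, w.val.1 n * (x : Fin (d 0) → ℝ) n) + w.val.2) * β1 w.val| ≤ C :=
    hbdd1.imp fun C h x w => h x w.val
  have hbs : ∀ ℓ : ℕ, ∃ C, ∀ (x : ↥X) (w : ↥(Ss (ℓ+2))),
      |σ (ℓ+2) (w.val.1 x + w.val.2) * βs (ℓ+2) w.val| ≤ C :=
    fun ℓ => (hbdds ℓ).imp fun C h x w => h x w.val w.2
  have hgood : ∀ ℓ, HGood (chainB (d 0) X σ β1 βs Set.univ Ss ℓ).1
      (chainB (d 0) X σ β1 βs Set.univ Ss ℓ).2 := by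
    intro ℓ
    induction ℓ with
    | zero => exact h_good _ hφ1 hb1
    | succ ℓ ih =>
      obtain ⟨hT, hO, hM⟩ := h_level _ _ ih _ (hSs ℓ) (σ (ℓ+2)) (hσmeas _) (βs (ℓ+2))
        (hβsmeas ℓ)
      letI : TopologicalSpace (↥X → ℝ) :=
        topOfNorm (chainB (d 0) X σ β1 βs Set.univ Ss ℓ).2
      letI : MeasurableSpace (↥X → ℝ) := borel _
      exact h_good _ hM (hbs ℓ)
  clear hL
  induction M with
  | zero =>
    have := h_net _ hφ1 hb1 (fun j => ⟨(W 0 j, bv 1 j), Set.mem_univ _⟩)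
      (fun j => WL j / β1 (W 0 j, bv 1 j))
      (fun x : ↥X => ∑ j, WL j *
        σ (0+1) (bv (0+1) j + preactV σ d W bv (x : Fin (d 0) → ℝ) 0 j)) ?_
    · refine ⟨this.1, this.2.trans (le_of_eq ?_)⟩
      refine Finset.sum_congr rfl fun j _ => ?_
      rw [abs_div, abs_of_pos (hβ1pos _)]
      rfl
    · intro x
      refine Finset.sum_congr rfl fun j _ => ?_
      have := (hβ1pos (W 0 j, bv 1 j)).ne'
      simp only [preactV, zero_add]
      rw [add_comm (bv 1 j)]
      field_simp
  | succ m ih =>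
    have hmem : ∀ j, ((fun x : ↥X => preactV σ d W bv (x : Fin (d 0) → ℝ) (m+1) j),
        bv (m+2) j) ∈ Ss (m+2) := by
      intro j
      rw [hSs m]
      exact ⟨(ih (W (m+1) j)).1, Set.mem_univ _⟩
    obtain ⟨hT, hO, hM⟩ := h_level _ _ (hgood m) _ (hSs m) (σ (m+2)) (hσmeas _) (βs (m+2))
      (hβsmeas m)
    letI : TopologicalSpace (↥X → ℝ) :=
      topOfNorm (chainB (d 0) X σ β1 βs Set.univ Ss m).2
    letI : MeasurableSpace (↥X → ℝ) := borel _
    have := h_net _ hM (hbs m) (fun j => ⟨_, hmem j⟩)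
      (fun j => WL j / denomV d X σ W bv β1 βs (m+1) j)
      (fun x : ↥X => ∑ j, WL j *
        σ (m+1+1) (bv (m+1+1) j + preactV σ d W bv (x : Fin (d 0) → ℝ) (m+1) j)) ?_
    · refine ⟨this.1, this.2.trans (le_of_eq ?_)⟩
      refine Finset.sum_congr rfl fun j _ => ?_
      have h0 : 0 < denomV d X σ W bv β1 βs (m+1) j := hβspos _ _
      rw [abs_div, abs_of_pos h0]
    · intro x
      refine Finset.sum_congr rfl fun j _ => ?_
      have h0 : denomV d X σ W bv β1 βs (m+1) j ≠ 0 := (hβspos _ _).ne'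
      rw [add_comm (bv (m+1+1) j)]
      change _ = WL j / denomV d X σ W bv β1 βs (m+1) j *
        (_ * denomV d X σ W bv β1 βs (m+1) j)
      field_simp

end
end

section
/- Let (B, B⋄) be an RKBS pair with domains X and Ω and reproducing kernel K. If X is a finite set, then B⋄ = span{K(x,·) : x ∈ X}, and with N = dim B⋄ there exist N elements w_1, …, w_N ∈ Ω such that {K(·,w_j) : j = 1,…,N} is a basis of B; in particular dim B = dim B⋄ = N. -/
/-!
STATEMENT 11: Let (B, B⋄) be an RKBS pair with domains X and Ω and reproducing kernel
K.  If X is finite, then B⋄ = span{K(x,·) : x ∈ X}, and with N = dim B⋄ there exist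
w_1, …, w_N ∈ Ω such that {K(·,w_j)} is a basis of B; in particular
dim B = dim B⋄ = N.
-/

noncomputable section

universe u v

theorem span_top_aux {A C ι : Type*} [AddCommGroup A] [Module ℝ A] [AddCommGroup C] [Module ℝ C]
    [FiniteDimensional ℝ A] [FiniteDimensional ℝ C]
    (p : A →ₗ[ℝ] C →ₗ[ℝ] ℝ) (hd : Module.finrank ℝ C = Module.finrank ℝ A)
    (a : ι → A) (h : ∀ c, (∀ i, p (a i) c = 0) → c = 0) :
    Submodule.span ℝ (Set.range a) = ⊤ := by
  have hinj : Function.Injective p.flip := by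
    rw [injective_iff_map_eq_zero]
    intro c hc
    apply h
    intro i
    have := LinearMap.congr_fun hc (a i)
    simpa using this
  have hsurj : Function.Surjective p.flip := by
    have hd' : Module.finrank ℝ C = Module.finrank ℝ (A →ₗ[ℝ] ℝ) := by
      rw [hd]; exact (Subspace.dual_finrank_eq (K := ℝ) (V := A)).symm
    exact (LinearMap.injective_iff_surjective_of_finrank_eq_finrank hd').1 hinj
  by_contra hne
  obtain ⟨φ, hφ, hle⟩ := Submodule.exists_le_ker_of_lt_top _ (lt_top_iff_ne_top.2 hne)
  obtain ⟨c, rfl⟩ := hsurj φ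
  apply hφ
  rw [h c, map_zero]
  intro i
  have := hle (Submodule.subset_span ⟨i, rfl⟩)
  simpa using this

/-- If `X` is finite then `B⋄` is spanned by the evaluation
functionals `K(x,·)`, both spaces are finite dimensional of the same dimension
`N = dim B⋄`, and there exist `w_1, …, w_N ∈ Ω` such that the `K(·,w_j)` form a basis
of `B`. -/
theorem statement11 {X : Type u} {Ω : Type v} [Finite X]
    (P : RKBSPair X Ω) (hP : P.IsRKBS)
    (K : X → Ω → ℝ) (Kx : X → P.Bd) (Kw : Ω → P.B) (hK : P.IsKernelWith K Kx Kw) :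
    FiniteDimensional ℝ P.Bd ∧ FiniteDimensional ℝ P.B ∧
    Module.finrank ℝ P.B = Module.finrank ℝ P.Bd ∧
    Submodule.span ℝ (Set.range Kx) = (⊤ : Submodule ℝ P.Bd) ∧
    ∃ w : Fin (Module.finrank ℝ P.Bd) → Ω,
      LinearIndependent ℝ (fun j => Kw (w j)) ∧
      Submodule.span ℝ (Set.range fun j => Kw (w j)) = (⊤ : Submodule ℝ P.B) := by
  obtain ⟨h1, h2, -, -, -, h6, h7⟩ := hP
  have fB : FiniteDimensional ℝ P.B := Module.Finite.of_injective P.evB h1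
  have i1 : Function.Injective P.dpair := by
    rw [injective_iff_map_eq_zero]
    intro g hg
    exact h6 g fun f => by rw [hg]; rfl
  have fBd : FiniteDimensional ℝ P.Bd := Module.Finite.of_injective P.dpair i1
  have i2 : Function.Injective P.dpair.flip := by
    rw [injective_iff_map_eq_zero]
    intro f hf
    exact h7 f fun g => by rw [← LinearMap.flip_apply, hf]; rfl
  have hd : Module.finrank ℝ P.B = Module.finrank ℝ P.Bd := by
    apply le_antisymm
    · exact (LinearMap.finrank_le_finrank_of_injective i2).trans
        (Subspace.dual_finrank_eq (K := ℝ) (V := P.Bd)).le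
    · exact (LinearMap.finrank_le_finrank_of_injective i1).trans
        (Subspace.dual_finrank_eq (K := ℝ) (V := P.B)).le
  refine ⟨fBd, fB, hd, ?_, ?_⟩
  · apply span_top_aux P.dpair hd
    intro f hf
    apply h1
    ext x
    rw [← hK.reproB, hf, map_zero]; rfl
  · have hs : Submodule.span ℝ (Set.range Kw) = ⊤ := by
      apply span_top_aux P.dpair.flip hd.symm
      intro g hg
      apply h2
      ext w
      rw [← hK.reproBd, ← LinearMap.flip_apply, hg, map_zero]; rfl
    obtain ⟨κ, a, -, hsp, hli⟩ := exists_linearIndependent' ℝ Kw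
    rw [hs] at hsp
    let b := Module.Basis.mk hli hsp.ge
    haveI : Fintype κ := FiniteDimensional.fintypeBasisIndex b
    have hc : Fintype.card κ = Module.finrank ℝ P.Bd := by
      rw [← hd, Module.finrank_eq_card_basis b]
    let e := (Fintype.equivFinOfCardEq hc).symm
    refine ⟨a ∘ e, hli.comp e e.injective, ?_⟩
    rw [← hsp]
    congr 1
    exact e.surjective.range_comp (Kw ∘ a)

end
end

section
/- Let (B, B⋄) be the integral RKBS pair on (X, Ω) associated with a bounded Borel-measurable kernel φ : X × Ω → ℝ, where X = {x_1, …, x_N} is finite. Then for any real coefficients a_1, …, a_N, sup{ Σ_{i=1}^N a_i f(x_i) : f ∈ B, ‖f‖_B ≤ 1 } = sup_{w ∈ Ω} | Σ_{i=1}^N a_i φ(x_i, w) | = ‖Σ_{i=1}^N a_i φ(x_i, ·)‖_{B⋄}. -/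
/-!
STATEMENT 16: Let (B, B⋄) be the integral RKBS pair on (X, Ω) associated with a
bounded Borel-measurable kernel φ, where X = {x_1, …, x_N} is finite.  Then for any
coefficients a_1, …, a_N,
sup{Σ_i a_i f(x_i) : f ∈ B, ‖f‖_B ≤ 1} = sup_w |Σ_i a_i φ(x_i, w)|
                                        = ‖Σ_i a_i φ(x_i, ·)‖_{B⋄}.
-/

noncomputable section

/-- The dual-side (supremum) norm on functions `Ω → ℝ`. -/
noncomputable def dualNorm {Ω : Type*} (g : Ω → ℝ) : ℝ := ⨆ w : Ω, |g w|

open MeasureTheory in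
theorem dirac_regular_aux {Ω : Type*} [TopologicalSpace Ω] [MeasurableSpace Ω] [BorelSpace Ω]
    [T2Space Ω] (w : Ω) : (Measure.dirac w).Regular := by
  have ho : (Measure.dirac w).OuterRegular := by
    refine ⟨fun A hA r hr => ?_⟩
    rw [Measure.dirac_apply] at hr
    by_cases hw : w ∈ A
    · refine ⟨Set.univ, Set.subset_univ _, isOpen_univ, ?_⟩
      simpa [hw] using hr
    · refine ⟨{w}ᶜ, ?_, isOpen_compl_singleton, ?_⟩
      · intro y hy hyw
        rw [Set.mem_singleton_iff] at hyw
        exact hw (hyw ▸ hy)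
      · rw [Measure.dirac_apply]
        simpa [hw] using hr
  refine { ho with lt_top_of_isCompact := fun K _ => measure_lt_top _ _, innerRegular := ?_ }
  intro U hU r hr
  rw [Measure.dirac_apply] at hr
  by_cases hw : w ∈ U
  · refine ⟨{w}, by simpa using hw, isCompact_singleton, ?_⟩
    rw [Measure.dirac_apply]
    simpa [hw] using hr
  · simp [hw] at hr

open MeasureTheory in
theorem dirac_rep_aux {Ω : Type*} [TopologicalSpace Ω] [MeasurableSpace Ω] [BorelSpace Ω]
    [T2Space Ω] (w : Ω) (c : ℝ) (hc : c = 1 ∨ c = -1) :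
    ∃ μ : SignedMeasure Ω, IsRadonSM μ ∧ tvnorm μ = 1 ∧ ∀ f : Ω → ℝ, sint μ f = c * f w := by
  let j : JordanDecomposition Ω :=
    { posPart := Measure.dirac w
      negPart := 0
      mutuallySingular := Measure.MutuallySingular.zero_right }
  have hreg := dirac_regular_aux w
  rcases hc with rfl | rfl
  · refine ⟨j.toSignedMeasure, ?_, ?_, ?_⟩
    · unfold IsRadonSM SignedMeasure.totalVariation
      rw [JordanDecomposition.toJordanDecomposition_toSignedMeasure]
      simpa [j] using hreg
    · unfold tvnorm SignedMeasure.totalVariation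
      rw [JordanDecomposition.toJordanDecomposition_toSignedMeasure]
      simp [j]
    · intro f
      unfold sint
      rw [JordanDecomposition.toJordanDecomposition_toSignedMeasure]
      simp [j]
  · refine ⟨(-j).toSignedMeasure, ?_, ?_, ?_⟩
    · unfold IsRadonSM SignedMeasure.totalVariation
      rw [JordanDecomposition.toJordanDecomposition_toSignedMeasure]
      simpa [j] using hreg
    · unfold tvnorm SignedMeasure.totalVariation
      rw [JordanDecomposition.toJordanDecomposition_toSignedMeasure]
      simp [j]
    · intro f
      unfold sint
      rw [JordanDecomposition.toJordanDecomposition_toSignedMeasure]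
      simp [j]

open MeasureTheory in
theorem sint_bound_aux {Ω : Type*} [MeasurableSpace Ω] (μ : SignedMeasure Ω) (g : Ω → ℝ)
    (M : ℝ) (hM : ∀ w, |g w| ≤ M) : sint μ g ≤ M * tvnorm μ := by
  unfold sint tvnorm SignedMeasure.totalVariation
  have h1 := norm_integral_le_of_norm_le_const (μ := μ.toJordanDecomposition.posPart) (f := g)
    (C := M) (Filter.Eventually.of_forall hM)
  have h2 := norm_integral_le_of_norm_le_const (μ := μ.toJordanDecomposition.negPart) (f := g)
    (C := M) (Filter.Eventually.of_forall hM)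
  rw [Measure.add_apply, ENNReal.toReal_add (measure_ne_top _ _) (measure_ne_top _ _)]
  rw [Real.norm_eq_abs, Measure.real] at h1 h2
  have := (abs_le.1 h1).2
  have := (abs_le.1 h2).1
  linarith

open MeasureTheory in
theorem sint_sum_aux {Ω : Type*} [MeasurableSpace Ω] (μ : SignedMeasure Ω) {N : ℕ}
    (a : Fin N → ℝ) (g : Fin N → Ω → ℝ) (hg : ∀ i, Measurable (g i)) (C : ℝ)
    (hC : ∀ i w, |g i w| ≤ C) :
    ∑ i, a i * sint μ (g i) = sint μ (fun w => ∑ i, a i * g i w) := by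
  have hi : ∀ (ν : Measure Ω) [IsFiniteMeasure ν] (i : Fin N), Integrable (g i) ν := fun ν _ i =>
    Integrable.of_bound (hg i).aestronglyMeasurable C (Filter.Eventually.of_forall (hC i))
  unfold sint
  rw [integral_finsetSum _ (fun i _ => (hi _ i).const_mul _),
    integral_finsetSum _ (fun i _ => (hi _ i).const_mul _), ← Finset.sum_sub_distrib]
  refine Finset.sum_congr rfl fun i _ => ?_
  rw [integral_const_mul, integral_const_mul, mul_sub]

/-- Over a finite domain `X = {x_1, …, x_N}`, the supremum of
`Σ_i a_i f(x_i)` over the unit ball of the integral RKBS `B` equals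
`sup_w |Σ_i a_i φ(x_i,w)|`, the `B⋄`-norm of `Σ_i a_i φ(x_i,·)`. -/
theorem statement16 {X Ω : Type*}
    [TopologicalSpace X] [MeasurableSpace X] [BorelSpace X]
    [CompletelyRegularSpace X] [T2Space X]
    [TopologicalSpace Ω] [MeasurableSpace Ω] [BorelSpace Ω]
    [CompletelyRegularSpace Ω] [T2Space Ω]
    (φ : X → Ω → ℝ) (hφmeas : Measurable (Function.uncurry φ))
    (C : ℝ) (hφbdd : ∀ (x : X) (w : Ω), |φ x w| ≤ C)
    -- X = {x_1, …, x_N} is finite: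
    (N : ℕ) (x : Fin N → X) (hx : Function.Surjective x)
    (a : Fin N → ℝ) :
    sSup {s : ℝ | ∃ f ∈ intSet φ, intNorm φ f ≤ 1 ∧ s = ∑ i, a i * f (x i)}
      = ⨆ w : Ω, |∑ i, a i * φ (x i) w| ∧
    (⨆ w : Ω, |∑ i, a i * φ (x i) w|)
      = dualNorm (fun w => ∑ i, a i * φ (x i) w) := by
  refine ⟨?_, rfl⟩
  have hmeas : ∀ y, Measurable (φ y) := fun y => hφmeas.comp measurable_prodMk_left
  have hbdd : BddAbove (Set.range fun w : Ω => |∑ i, a i * φ (x i) w|) := by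
    refine ⟨∑ i, |a i| * C, ?_⟩
    rintro _ ⟨w, rfl⟩
    refine (Finset.abs_sum_le_sum_abs _ _).trans (Finset.sum_le_sum fun i _ => ?_)
    rw [abs_mul]
    exact mul_le_mul_of_nonneg_left (hφbdd _ _) (abs_nonneg _)
  have hM0 : 0 ≤ ⨆ w : Ω, |∑ i, a i * φ (x i) w| := Real.iSup_nonneg fun w => abs_nonneg _
  have hub : ∀ s ∈ {s : ℝ | ∃ f ∈ intSet φ, intNorm φ f ≤ 1 ∧ s = ∑ i, a i * f (x i)},
      s ≤ ⨆ w : Ω, |∑ i, a i * φ (x i) w| := by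
    rintro s ⟨f, ⟨μ, hμ, hf⟩, hn, rfl⟩
    refine le_of_forall_pos_le_add fun ε hε => ?_
    set M := ⨆ w : Ω, |∑ i, a i * φ (x i) w| with hMdef
    have hδ : 0 < ε / (M + 1) := by positivity
    obtain ⟨r, ⟨ν, hν, hfν, rfl⟩, hr⟩ := exists_lt_of_csInf_lt
      (s := {r | ∃ μ : MeasureTheory.SignedMeasure Ω, IsRadonSM μ ∧
        (∀ x, f x = sint μ (φ x)) ∧ r = tvnorm μ}) ⟨_, μ, hμ, hf, rfl⟩
      (lt_of_le_of_lt hn (lt_add_of_pos_right 1 hδ))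
    have e : ∑ i, a i * f (x i) = sint ν (fun w => ∑ i, a i * φ (x i) w) := by
      rw [← sint_sum_aux ν a (fun i => φ (x i)) (fun i => hmeas _) C (fun i w => hφbdd _ _)]
      exact Finset.sum_congr rfl fun i _ => by rw [hfν]
    rw [e]
    refine (sint_bound_aux ν _ M fun w => le_ciSup hbdd w).trans ?_
    refine (mul_le_mul_of_nonneg_left hr.le hM0).trans ?_
    have h3 : M * (ε / (M + 1)) ≤ ε := by
      rw [← mul_div_assoc, div_le_iff₀ (by positivity)]
      nlinarith
    linarith
  apply le_antisymm
  · exact Real.sSup_le hub hM0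
  · have key : ∀ w (c : ℝ), (c = 1 ∨ c = -1) → c * (∑ i, a i * φ (x i) w) ≤
        sSup {s : ℝ | ∃ f ∈ intSet φ, intNorm φ f ≤ 1 ∧ s = ∑ i, a i * f (x i)} := by
      intro w c hc
      obtain ⟨μ, hμ, h1, hs⟩ := dirac_rep_aux w c hc
      refine le_csSup ⟨_, hub⟩ ⟨fun y => c * φ y w, ⟨μ, hμ, fun y => (hs _).symm⟩, ?_, ?_⟩
      · refine csInf_le ⟨0, ?_⟩ ⟨μ, hμ, fun y => (hs _).symm, h1.symm⟩
        rintro r ⟨ν, -, -, rfl⟩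
        exact ENNReal.toReal_nonneg
      · rw [Finset.mul_sum]
        exact Finset.sum_congr rfl fun i _ => by ring
    refine Real.iSup_le (fun w => ?_) ?_
    · refine abs_le'.2 ⟨by simpa using key w 1 (Or.inl rfl), by simpa using key w (-1) (Or.inr rfl)⟩
    · rcases isEmpty_or_nonempty Ω with h | ⟨⟨w⟩⟩
      · refine Real.sSup_nonneg ?_
        rintro s ⟨f, ⟨μ, hμ, hf⟩, hn, rfl⟩
        refine (Finset.sum_eq_zero fun i _ => ?_).ge
        rw [hf]
        simp [sint, MeasureTheory.Measure.eq_zero_of_isEmpty]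
      · have h1 := key w 1 (Or.inl rfl)
        have h2 := key w (-1) (Or.inr rfl)
        linarith

end
end

section
/- Let (B, B⋄) be the integral RKBS pair on (X, Ω) associated with a bounded Borel-measurable kernel φ : X × Ω → ℝ, where X = {x_1, …, x_N} is finite. Let ξ_1, …, ξ_N be i.i.d. Rademacher random variables (each uniform on {−1, +1}), and let G_ξ = Σ_{i=1}^N ξ_i φ(x_i, ·), a B⋄-valued random variable. Then the empirical Rademacher complexity of the unit ball of B over X satisfies Rad_X({f ∈ B : ‖f‖_B ≤ 1}) := (1/N)·E_ξ[ sup_{f ∈ B, ‖f‖_B ≤ 1} Σ_{i=1}^N ξ_i f(x_i) ] = (1/N)·E_ξ[ ‖G_ξ‖_{B⋄} ] = (1/N)·E_ξ[ sup_{w ∈ Ω} | Σ_{i=1}^N ξ_i φ(x_i, w) | ]. -/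
/-!
STATEMENT 17: Let (B, B⋄) be the integral RKBS pair on (X, Ω) associated with a
bounded Borel-measurable kernel φ, with X = {x_1, …, x_N} finite.  For i.i.d.
Rademacher variables ξ_1, …, ξ_N (i.e. a uniform sign vector in {−1,+1}^N) and
G_ξ = Σ_i ξ_i φ(x_i, ·) ∈ B⋄, the empirical Rademacher complexity of the unit ball of
B satisfies
Rad_X({f : ‖f‖_B ≤ 1}) = (1/N)·E_ξ[sup_{‖f‖_B ≤ 1} Σ_i ξ_i f(x_i)]
                       = (1/N)·E_ξ[‖G_ξ‖_{B⋄}] = (1/N)·E_ξ[sup_w |Σ_i ξ_i φ(x_i,w)|].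
The expectation over the i.i.d. Rademacher vector is written as the uniform average
over all 2^N sign patterns ε : Fin N → Bool, with ξ_i = 1 if ε i and −1 otherwise.
-/

noncomputable section

/-- The sign `ξ_i ∈ {−1, +1}` associated with a Boolean. -/
def radSign (b : Bool) : ℝ := if b then 1 else -1

open MeasureTheory in
theorem aux_dirac_regular {α : Type*} [TopologicalSpace α] [MeasurableSpace α] [BorelSpace α]
    [T2Space α] (w : α) : (Measure.dirac w).Regular := by
  refine { outerRegular := ?_, innerRegular := ?_ }
  · intro A hA r hr
    by_cases hw : w ∈ A
    · refine ⟨Set.univ, Set.subset_univ _, isOpen_univ, ?_⟩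
      rw [Measure.dirac_apply_of_mem hw] at hr
      simpa using hr
    · refine ⟨{w}ᶜ, ?_, isOpen_compl_singleton, ?_⟩
      · intro a ha h
        exact hw (by rw [Set.mem_singleton_iff] at h; exact h ▸ ha)
      · have : Measure.dirac w ({w}ᶜ : Set α) = 0 := by simp
        rw [this]
        exact lt_of_le_of_lt (zero_le) hr
  · intro U hU r hr
    by_cases hw : w ∈ U
    · refine ⟨{w}, by simpa using hw, isCompact_singleton, ?_⟩
      rw [Measure.dirac_apply_of_mem hw] at hr
      simpa using hr
    · rw [Measure.dirac_apply' _ hU.measurableSet] at hr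
      simp [hw] at hr

open MeasureTheory in
theorem aux_bound {α : Type*} [MeasurableSpace α] (μ : SignedMeasure α) (g : α → ℝ)
    (M : ℝ) (hM : ∀ w, |g w| ≤ M) : |sint μ g| ≤ M * tvnorm μ := by
  have h1 : |∫ a, g a ∂μ.toJordanDecomposition.posPart|
      ≤ M * (μ.toJordanDecomposition.posPart).real Set.univ := by
    rw [← Real.norm_eq_abs]
    exact norm_integral_le_of_norm_le_const (Filter.Eventually.of_forall hM)
  have h2 : |∫ a, g a ∂μ.toJordanDecomposition.negPart|
      ≤ M * (μ.toJordanDecomposition.negPart).real Set.univ := by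
    rw [← Real.norm_eq_abs]
    exact norm_integral_le_of_norm_le_const (Filter.Eventually.of_forall hM)
  have h3 : tvnorm μ = (μ.toJordanDecomposition.posPart).real Set.univ
      + (μ.toJordanDecomposition.negPart).real Set.univ := by
    unfold tvnorm SignedMeasure.totalVariation
    rw [Measure.add_apply, ENNReal.toReal_add (measure_ne_top _ _) (measure_ne_top _ _)]
    rfl
  rw [h3, mul_add]
  unfold sint
  exact (abs_sub _ _).trans (add_le_add h1 h2)

open MeasureTheory in
theorem aux_lin {α : Type*} [MeasurableSpace α] (μ : SignedMeasure α) {N : ℕ} (c : Fin N → ℝ)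
    (g : Fin N → α → ℝ) (hg : ∀ i, Measurable (g i)) (C : ℝ) (hC : ∀ i w, |g i w| ≤ C) :
    ∑ i, c i * sint μ (g i) = sint μ (fun w => ∑ i, c i * g i w) := by
  have hi : ∀ (ν : Measure α) [IsFiniteMeasure ν],
      ∫ w, ∑ i, c i * g i w ∂ν = ∑ i, c i * ∫ w, g i w ∂ν := by
    intro ν _
    rw [integral_finsetSum]
    · simp_rw [integral_const_mul]
    · intro i _
      exact (Integrable.of_bound (hg i).aestronglyMeasurable C
        (Filter.Eventually.of_forall (hC i))).const_mul _
  unfold sint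
  rw [hi, hi, ← Finset.sum_sub_distrib]
  simp_rw [mul_sub]

open MeasureTheory in
theorem aux_jordan {α : Type*} [TopologicalSpace α] [MeasurableSpace α]
    {D : Type*} (φ : D → α → ℝ) (j : JordanDecomposition α)
    (hr : (j.posPart + j.negPart).Regular) (h1 : (j.posPart + j.negPart) Set.univ ≤ 1)
    (f : D → ℝ) (hf : ∀ x, f x = ∫ a, φ x a ∂j.posPart - ∫ a, φ x a ∂j.negPart) :
    f ∈ intSet φ ∧ intNorm φ f ≤ 1 := by
  have hj : IsRadonSM j.toSignedMeasure := by
    unfold IsRadonSM SignedMeasure.totalVariation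
    rw [JordanDecomposition.toJordanDecomposition_toSignedMeasure]
    exact hr
  have hs : ∀ x, f x = sint j.toSignedMeasure (φ x) := by
    intro x
    unfold sint
    rw [JordanDecomposition.toJordanDecomposition_toSignedMeasure]
    exact hf x
  have ht : tvnorm j.toSignedMeasure ≤ 1 := by
    unfold tvnorm SignedMeasure.totalVariation
    rw [JordanDecomposition.toJordanDecomposition_toSignedMeasure]
    exact ENNReal.toReal_le_of_le_ofReal zero_le_one (by simpa using h1)
  refine ⟨⟨_, hj, hs⟩, le_trans (csInf_le ⟨0, ?_⟩ ⟨_, hj, hs, rfl⟩) ht⟩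
  rintro r ⟨μ, -, -, rfl⟩
  exact ENNReal.toReal_nonneg

open MeasureTheory in
theorem aux_main {X Ω : Type*}
    [TopologicalSpace Ω] [MeasurableSpace Ω] [BorelSpace Ω] [T2Space Ω]
    (φ : X → Ω → ℝ) (hφ : ∀ x, Measurable (φ x))
    (C : ℝ) (hφbdd : ∀ (x : X) (w : Ω), |φ x w| ≤ C)
    (N : ℕ) (x : Fin N → X) (c : Fin N → ℝ) :
    sSup {s : ℝ | ∃ f ∈ intSet φ, intNorm φ f ≤ 1 ∧ s = ∑ i, c i * f (x i)}
      = ⨆ w : Ω, |∑ i, c i * φ (x i) w| := by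
  set M := ⨆ w : Ω, |∑ i, c i * φ (x i) w| with hMdef
  have hbdd : BddAbove (Set.range fun w : Ω => |∑ i, c i * φ (x i) w|) := by
    refine ⟨∑ i, |c i| * C, ?_⟩
    rintro _ ⟨w, rfl⟩
    refine (Finset.abs_sum_le_sum_abs _ _).trans (Finset.sum_le_sum fun i _ => ?_)
    rw [abs_mul]
    exact mul_le_mul_of_nonneg_left (hφbdd _ _) (abs_nonneg _)
  have hM : ∀ w, |∑ i, c i * φ (x i) w| ≤ M := fun w => le_ciSup hbdd w
  have hM0 : 0 ≤ M := Real.iSup_nonneg fun w => abs_nonneg _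
  have hub : ∀ s ∈ {s : ℝ | ∃ f ∈ intSet φ, intNorm φ f ≤ 1 ∧ s = ∑ i, c i * f (x i)},
      s ≤ M := by
    rintro s ⟨f, ⟨μ₀, hμ₀, hf₀⟩, hn, rfl⟩
    have key : ∀ δ > 0, ∑ i, c i * f (x i) ≤ M * (1 + δ) := by
      intro δ hδ
      obtain ⟨r, ⟨μ, hμ, hf, rfl⟩, hr⟩ := exists_lt_of_csInf_lt
        (s := {r | ∃ μ : SignedMeasure Ω, IsRadonSM μ ∧ (∀ x, f x = sint μ (φ x)) ∧
          r = tvnorm μ}) ⟨_, μ₀, hμ₀, hf₀, rfl⟩ (lt_of_le_of_lt hn (by linarith : 1 < 1 + δ))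
      simp_rw [hf]
      rw [aux_lin μ c (fun i => φ (x i)) (fun i => hφ _) C (fun i => hφbdd _)]
      refine (le_abs_self _).trans ((aux_bound μ _ M hM).trans ?_)
      exact mul_le_mul_of_nonneg_left hr.le hM0
    refine le_of_forall_pos_le_add fun e he => ?_
    refine (key (e / (M + 1)) (by positivity)).trans ?_
    have : M * (e / (M + 1)) ≤ e := by
      rw [← mul_div_assoc, div_le_iff₀ (by positivity)]
      nlinarith
    linarith
  have hba : BddAbove {s : ℝ | ∃ f ∈ intSet φ, intNorm φ f ≤ 1 ∧ s = ∑ i, c i * f (x i)} :=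
    ⟨M, hub⟩
  have h0 : (0 : ℝ) ∈ {s : ℝ | ∃ f ∈ intSet φ, intNorm φ f ≤ 1 ∧ s = ∑ i, c i * f (x i)} := by
    obtain ⟨h1, h2⟩ := aux_jordan φ ⟨0, 0, Measure.MutuallySingular.zero_right⟩
      (by simp only [add_zero]; infer_instance) (by simp) (fun _ => 0) (by simp)
    exact ⟨_, h1, h2, by simp⟩
  apply le_antisymm
  · exact csSup_le ⟨0, h0⟩ hub
  · refine Real.iSup_le (fun w => ?_) (le_csSup hba h0)
    have hreg := aux_dirac_regular w
    rcases abs_cases (∑ i, c i * φ (x i) w) with ⟨h, -⟩ | ⟨h, -⟩ <;> rw [h]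
    · obtain ⟨h1, h2⟩ := aux_jordan φ ⟨Measure.dirac w, 0, Measure.MutuallySingular.zero_right⟩
        (by simpa only [add_zero] using hreg) (by simp) (fun y => φ y w)
        (by intro y; simp [integral_dirac])
      exact le_csSup hba ⟨_, h1, h2, rfl⟩
    · obtain ⟨h1, h2⟩ := aux_jordan φ ⟨0, Measure.dirac w, Measure.MutuallySingular.zero_left⟩
        (by simpa only [zero_add] using hreg) (by simp) (fun y => -φ y w)
        (by intro y; simp [integral_dirac])
      exact le_csSup hba ⟨_, h1, h2, by simp⟩

/-- The empirical Rademacher complexity of the unit ball of the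
integral RKBS `B` over the finite set `X = {x_1, …, x_N}` equals the expected
dual-side (supremum) norm of `G_ξ = Σ_i ξ_i φ(x_i, ·)`, the expectation being the
uniform average over all `2^N` sign vectors. -/
theorem statement17 {X Ω : Type*}
    [TopologicalSpace X] [MeasurableSpace X] [BorelSpace X]
    [CompletelyRegularSpace X] [T2Space X]
    [TopologicalSpace Ω] [MeasurableSpace Ω] [BorelSpace Ω]
    [CompletelyRegularSpace Ω] [T2Space Ω]
    (φ : X → Ω → ℝ) (hφmeas : Measurable (Function.uncurry φ))
    (C : ℝ) (hφbdd : ∀ (x : X) (w : Ω), |φ x w| ≤ C)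
    -- X = {x_1, …, x_N} is finite:
    (N : ℕ) (x : Fin N → X) (hx : Function.Surjective x) :
    -- (1/N)·E_ξ[sup_{‖f‖_B ≤ 1} Σ_i ξ_i f(x_i)] = (1/N)·E_ξ[‖G_ξ‖_{B⋄}]:
    (N : ℝ)⁻¹ * ((2 ^ N : ℝ)⁻¹ * ∑ ε : Fin N → Bool,
        sSup {s : ℝ | ∃ f ∈ intSet φ, intNorm φ f ≤ 1 ∧
          s = ∑ i, radSign (ε i) * f (x i)})
      = (N : ℝ)⁻¹ * ((2 ^ N : ℝ)⁻¹ * ∑ ε : Fin N → Bool,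
          ⨆ w : Ω, |∑ i, radSign (ε i) * φ (x i) w|) := by
  have hφ : ∀ y, Measurable (φ y) := fun y => hφmeas.comp measurable_prodMk_left
  congr 2
  exact Finset.sum_congr rfl fun ε _ =>
    aux_main φ hφ C hφbdd N x (fun i => radSign (ε i))

end
end
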